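/- Let M = (Q, W, R) be a hereditary abelian model structure on an abelian category A with core ω = Q ∩ W ∩ R, let A be cofibrant, and let W_A be an M-resolution of A. If a morphism h : B₁ → B₂ factors through an object of W ∩ R, then Hⁿ[Hom_A(W_A, h)] = 0 for all n. In particular, ℓExtⁿ_M(A, −) identifies left homotopic maps. -/

import Mathlib

open CategoryTheory CategoryTheory.Limits

universe w v u

variable {C : Type u} [Category.{v} C] [Abelian C]

/-- A hereditary abelian model structure (Hovey triple) `(𝒬, 𝒲, ℛ)` on an abelian
category: `𝒲` is thick, `(𝒬, 𝒲 ∩ ℛ)` and `(𝒬 ∩ 𝒲, ℛ)` are complete cotorsion pairs, and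
both cotorsion pairs are hereditary (`Extⁱ` vanishes for all `i ≥ 1`). -/
structure HoveyTriple (C : Type u) [Category.{v} C] [Abelian C] [HasExt.{w} C] where
  Q : C → Prop
  W : C → Prop
  R : C → Prop
  /-- `𝒲` is closed under retracts. -/
  thick_retract : ∀ ⦃X Y : C⦄, (∃ (s : Y ⟶ X) (r : X ⟶ Y), s ≫ r = 𝟙 Y) → W X → W Y
  /-- `𝒲` satisfies the two-out-of-three property on short exact sequences. -/
  thick_two_of_three : ∀ ⦃X Y Z : C⦄ (i : X ⟶ Y) (p : Y ⟶ Z) (w : i ≫ p = 0),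
    (ShortComplex.mk i p w).ShortExact →
      ((W X → W Y → W Z) ∧ (W X → W Z → W Y) ∧ (W Y → W Z → W X))
  /-- `Ext¹`-orthogonality of `𝒬` and `𝒲 ∩ ℛ`. -/
  orth₁ : ∀ ⦃X Y : C⦄, Q X → W Y → R Y → Subsingleton (Abelian.Ext X Y 1)
  orth₁_left : ∀ ⦃X : C⦄, (∀ Y : C, W Y → R Y → Subsingleton (Abelian.Ext X Y 1)) → Q X
  orth₁_right : ∀ ⦃Y : C⦄, (∀ X : C, Q X → Subsingleton (Abelian.Ext X Y 1)) → W Y ∧ R Y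
  /-- `Ext¹`-orthogonality of `𝒬 ∩ 𝒲` and `ℛ`. -/
  orth₂ : ∀ ⦃X Y : C⦄, Q X → W X → R Y → Subsingleton (Abelian.Ext X Y 1)
  orth₂_left : ∀ ⦃X : C⦄, (∀ Y : C, R Y → Subsingleton (Abelian.Ext X Y 1)) → Q X ∧ W X
  orth₂_right : ∀ ⦃Y : C⦄, (∀ X : C, Q X → W X → Subsingleton (Abelian.Ext X Y 1)) → R Y
  /-- the cotorsion pair `(𝒬, 𝒲 ∩ ℛ)` has enough projectives. -/
  complete₁_proj : ∀ A : C, ∃ (K E : C) (i : K ⟶ E) (p : E ⟶ A) (w : i ≫ p = 0),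
    Q E ∧ W K ∧ R K ∧ (ShortComplex.mk i p w).ShortExact
  /-- the cotorsion pair `(𝒬, 𝒲 ∩ ℛ)` has enough injectives. -/
  complete₁_inj : ∀ A : C, ∃ (E K : C) (i : A ⟶ E) (p : E ⟶ K) (w : i ≫ p = 0),
    W E ∧ R E ∧ Q K ∧ (ShortComplex.mk i p w).ShortExact
  /-- the cotorsion pair `(𝒬 ∩ 𝒲, ℛ)` has enough projectives. -/
  complete₂_proj : ∀ A : C, ∃ (K E : C) (i : K ⟶ E) (p : E ⟶ A) (w : i ≫ p = 0),
    Q E ∧ W E ∧ R K ∧ (ShortComplex.mk i p w).ShortExact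
  /-- the cotorsion pair `(𝒬 ∩ 𝒲, ℛ)` has enough injectives. -/
  complete₂_inj : ∀ A : C, ∃ (E K : C) (i : A ⟶ E) (p : E ⟶ K) (w : i ≫ p = 0),
    R E ∧ Q K ∧ W K ∧ (ShortComplex.mk i p w).ShortExact
  /-- heredity of `(𝒬, 𝒲 ∩ ℛ)`. -/
  hereditary₁ : ∀ ⦃X Y : C⦄ (i : ℕ), 1 ≤ i → Q X → W Y → R Y →
    Subsingleton (Abelian.Ext X Y i)
  /-- heredity of `(𝒬 ∩ 𝒲, ℛ)`. -/
  hereditary₂ : ∀ ⦃X Y : C⦄ (i : ℕ), 1 ≤ i → Q X → W X → R Y →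
    Subsingleton (Abelian.Ext X Y i)

variable [HasExt.{w} C]

/-- An `𝔐`-resolution of `A`: an everywhere-exact `ℤ`-indexed complex obtained by splicing
a resolution of `A` with components in `𝒬 ∩ 𝒲` and kernels in `ℛ` together with a
coresolution of `A` with components in `𝒲 ∩ ℛ` and cokernels in `𝒬`. -/
structure MResolution (M : HoveyTriple.{w} C) (A : C) where
  c : ChainComplex C ℤ
  ε : c.X 0 ⟶ A
  η : A ⟶ c.X (-1)
  epi : Epi ε
  mono : Mono η
  fac : c.d 0 (-1) = ε ≫ η
  comp_pos : ∀ n : ℤ, 0 ≤ n → M.Q (c.X n) ∧ M.W (c.X n)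
  comp_neg : ∀ n : ℤ, n < 0 → M.W (c.X n) ∧ M.R (c.X n)
  exact : ∀ n : ℤ, (ShortComplex.mk (c.d (n + 1) n) (c.d n (n - 1)) (c.d_comp_d _ _ _)).Exact
  ker_eps : M.R (kernel ε)
  ker_d : ∀ n : ℤ, 1 ≤ n → M.R (kernel (c.d n (n - 1)))
  cok_eta : M.Q (cokernel η)
  cok_d : ∀ n : ℤ, n ≤ -1 → M.Q (cokernel (c.d n (n - 1)))


theorem aux_shortExact {X Y Z : C} (f : X ⟶ Y) (g : Y ⟶ Z) (w : f ≫ g = 0)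
    (hS : (ShortComplex.mk f g w).Exact) :
    (ShortComplex.mk (cokernel.desc f g w) (cokernel.π g)
      (by rw [← cancel_epi (cokernel.π f)]; simp)).ShortExact := by
  have hm : Mono (cokernel.desc f g w) := hS.mono_cokernelDesc
  refine ⟨ShortComplex.exact_of_g_is_cokernel _ ?_⟩
  refine CokernelCofork.IsColimit.ofπ _ _ (fun k hk => cokernel.desc g k ?_) ?_ ?_
  · have := cokernel.π f ≫= hk
    simpa using this
  · intro Z' k hk
    simp
  · intro Z' k hk m hm
    rw [← cancel_epi (cokernel.π g)]
    simpa using hm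

theorem aux_Q_iso (M : HoveyTriple.{w} C) {X Y : C} (e : X ≅ Y) (h : M.Q X) : M.Q Y := by
  refine M.orth₁_left fun T hW hR => ⟨fun x y => ?_⟩
  have := M.orth₁ h hW hR
  have key : ∀ x : Abelian.Ext Y T 1, x = (Abelian.Ext.mk₀ e.inv).comp
      ((Abelian.Ext.mk₀ e.hom).comp x (zero_add 1)) (zero_add 1) := by
    intro x
    rw [Abelian.Ext.mk₀_comp_mk₀_assoc, e.inv_hom_id, Abelian.Ext.mk₀_id_comp]
  rw [key x, key y]
  congr 1
  exact Subsingleton.elim _ _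

theorem aux_Q_ker (M : HoveyTriple.{w} C) (S : ShortComplex C) (hS : S.ShortExact)
    (h2 : M.Q S.X₂) (h3 : M.Q S.X₃) : M.Q S.X₁ := by
  refine M.orth₁_left fun T hW hR => ?_
  have i2 := M.orth₁ h2 hW hR
  have i3 := M.hereditary₁ 2 (by norm_num) h3 hW hR
  have key : ∀ x : Abelian.Ext S.X₁ T 1, x = 0 := by
    intro x
    obtain ⟨y, rfl⟩ := Abelian.Ext.contravariant_sequence_exact₁ hS T x (n₁ := 2) rfl
      (Subsingleton.elim _ _)
    rw [Subsingleton.elim y 0, Abelian.Ext.comp_zero]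
  exact ⟨fun x y => by rw [key x, key y]⟩

theorem aux_extend (S : ShortComplex C) (hS : S.ShortExact) (T : C)
    (h : Subsingleton (Abelian.Ext S.X₃ T 1)) (φ : S.X₁ ⟶ T) : ∃ ψ : S.X₂ ⟶ T, S.f ≫ ψ = φ := by
  obtain ⟨y, hy⟩ := Abelian.Ext.contravariant_sequence_exact₁ hS T (Abelian.Ext.mk₀ φ) (n₁ := 1) rfl
      (Subsingleton.elim _ _)
  obtain ⟨ψ, rfl⟩ := (Abelian.Ext.mk₀_bijective _ _).2 y
  refine ⟨ψ, (Abelian.Ext.mk₀_bijective _ _).1 ?_⟩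
  rw [← hy, Abelian.Ext.mk₀_comp_mk₀]

theorem aux_exact {M : HoveyTriple.{w} C} {A : C} (WA : MResolution M A) (i j k : ℤ)
    (hi : i = j + 1) (hk : k = j - 1) :
    (ShortComplex.mk (WA.c.d i j) (WA.c.d j k) (WA.c.d_comp_d _ _ _)).Exact := by
  subst hi hk
  exact WA.exact j

theorem aux_Q_one {M : HoveyTriple.{w} C} {A : C} (hA : M.Q A) (WA : MResolution M A) :
    M.Q (cokernel (WA.c.d 1 0)) := by
  have := WA.epi
  have := WA.mono
  have hz : WA.c.d 1 0 ≫ WA.ε = 0 := by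
    rw [← cancel_mono WA.η, Category.assoc, ← WA.fac]
    simp
  have hm : Mono (cokernel.desc (WA.c.d 1 0) (WA.c.d 0 (-1)) (WA.c.d_comp_d _ _ _)) :=
    (aux_exact WA 1 0 (-1) (by norm_num) (by norm_num)).mono_cokernelDesc
  have hc : cokernel.desc (WA.c.d 1 0) (WA.c.d 0 (-1)) (WA.c.d_comp_d _ _ _) =
      cokernel.desc (WA.c.d 1 0) WA.ε hz ≫ WA.η := by
    rw [← cancel_epi (cokernel.π _)]
    simp [WA.fac]
  rw [hc] at hm
  have : Mono (cokernel.desc (WA.c.d 1 0) WA.ε hz) := mono_of_mono _ WA.η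
  have : Epi (cokernel.desc (WA.c.d 1 0) WA.ε hz) :=
    epi_of_epi_fac (cokernel.π_desc (WA.c.d 1 0) WA.ε hz)
  have : IsIso (cokernel.desc (WA.c.d 1 0) WA.ε hz) := isIso_of_mono_of_epi _
  exact aux_Q_iso M (asIso (cokernel.desc (WA.c.d 1 0) WA.ε hz)).symm hA

theorem aux_Q_pos {M : HoveyTriple.{w} C} {A : C} (hA : M.Q A) (WA : MResolution M A) (m : ℕ) :
    ∀ i j : ℤ, i = m + 1 → j = m → M.Q (cokernel (WA.c.d i j)) := by
  induction m with
  | zero =>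
    rintro i j hi hj
    obtain rfl : i = 1 := by simpa using hi
    obtain rfl : j = 0 := by simpa using hj
    exact aux_Q_one hA WA
  | succ m ih =>
    intro i j hi hj
    push_cast at hi hj
    exact aux_Q_ker M _ (aux_shortExact _ _ _ (aux_exact WA i j m (by lia) (by lia)))
      (WA.comp_pos m (by lia)).1 (ih j m hj rfl)

theorem aux_Q {M : HoveyTriple.{w} C} {A : C} (hA : M.Q A) (WA : MResolution M A) (n : ℤ) :
    M.Q (cokernel (WA.c.d n (n - 1))) := by
  rcases lt_trichotomy n 0 with h | h | h
  · exact WA.cok_d n (by lia)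
  · subst h
    have := WA.epi
    change M.Q (cokernel (WA.c.d 0 (-1)))
    rw [WA.fac]
    exact aux_Q_iso M (cokernelEpiComp WA.ε WA.η).symm WA.cok_eta
  · exact aux_Q_pos hA WA (n - 1).toNat n (n - 1) (by lia) (by lia)

/-- for `A` cofibrant and `W_A` an `𝔐`-resolution of `A`, if `h : B₁ ⟶ B₂`
factors through an object of `𝒲 ∩ ℛ` then the induced map `Hⁿ[Hom(W_A, h)]` is zero for
all `n`: the image of every cocycle is a coboundary.  (In particular `ℓExtⁿ_𝔐(A, −)`
identifies left homotopic maps.) -/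
theorem statement11 (M : HoveyTriple.{w} C) (A : C) (hA : M.Q A) (WA : MResolution M A)
    (B₁ B₂ : C) (h : B₁ ⟶ B₂)
    (Rt : C) (hRt : M.W Rt ∧ M.R Rt) (a : B₁ ⟶ Rt) (b : Rt ⟶ B₂) (hh : h = a ≫ b)
    (n : ℤ) (f : WA.c.X n ⟶ B₁) (hf : WA.c.d (n + 1) n ≫ f = 0) :
    ∃ t : WA.c.X (n - 1) ⟶ B₂, f ≫ h = WA.c.d n (n - 1) ≫ t := by
  obtain ⟨ψ, hψ⟩ := aux_extend _ (aux_shortExact _ _ _ (WA.exact n)) Rt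
    (M.orth₁ (aux_Q hA WA n) hRt.1 hRt.2)
    (cokernel.desc (WA.c.d (n + 1) n) (f ≫ a) (by rw [← Category.assoc, hf, zero_comp]))
  refine ⟨ψ ≫ b, ?_⟩
  have := cokernel.π (WA.c.d (n + 1) n) ≫= hψ
  simp only [cokernel.π_desc, cokernel.π_desc_assoc] at this
  rw [hh, ← Category.assoc, ← Category.assoc, this]
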